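/- Suppose (M_H, I_H) is a τ-abstraction of (M_L, I_L), the model (M_L, I_L) is similar to (M_L', I_L) and is a d_max-α-approximation of (M_L', I_L), and k ≥ 0 is a constant such that for every intervention (X ← x) ∈ I_L and every context u_L ∈ R(U_L), d_{V_H}(τ(M_L'(u_L, X ← x)), τ(M_L(u_L, X ← x))) ≤ k · d_{V_L}(M_L'(u_L, X ← x), M_L(u_L, X ← x)). Then (M_H, I_H) is a τ-(k·α)-approximate abstraction of (M_L', I_L). -/

import Mathlib

open Classical

/-- An intervention `X ← x`, as a partial assignment of values to the
endogenous variables. -/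
abbrev Intervention (V : Type) (R : V → Type) : Type := ∀ v : V, Option (R v)

/-- `Rst i` is the set of endogenous states that agree with intervention `i`
on all intervened variables. -/
def Rst {V : Type} {R : V → Type} (i : Intervention V R) : Set (∀ v, R v) :=
  {s | ∀ (v : V) (a : R v), i v = some a → s v = a}

/-- `d_max(M₁, M₂)` for similar models: the maximum over allowed interventions
and contexts of the distance between `M₁(u, X ← x)` and `M₂(u, X ← x)`. -/
noncomputable def dMax {Ctx V : Type} {R : V → Type}
    (dV : (∀ v, R v) → (∀ v, R v) → ℝ)
    (I : Set (Intervention V R))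
    (M₁ M₂ : Ctx → Intervention V R → (∀ v, R v)) : ℝ :=
  sSup {b | ∃ i ∈ I, ∃ u : Ctx, b = dV (M₁ u i) (M₂ u i)}

/-- The distance `d_τ(M_L, M_H)`: the minimum over surjective
`τ_U : R(U_L) → R(U_H)` of the maximum over interventions in `I_L` and
contexts of `d_{V_H}(τ(M_L(u, X ← x)), M_H(τ_U(u), ω_τ(X ← x)))`. -/
noncomputable def dTau {CtxL CtxH VL VH : Type} {RL : VL → Type} {RH : VH → Type}
    (dH : (∀ v, RH v) → (∀ v, RH v) → ℝ)
    (τ : (∀ v, RL v) → (∀ v, RH v))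
    (ω : Intervention VL RL → Intervention VH RH)
    (IL : Set (Intervention VL RL))
    (ML : CtxL → Intervention VL RL → (∀ v, RL v))
    (MH : CtxH → Intervention VH RH → (∀ v, RH v)) : ℝ :=
  sInf {a | ∃ τU : CtxL → CtxH, Function.Surjective τU ∧
      a = sSup {b | ∃ i ∈ IL, ∃ u : CtxL,
            b = dH (τ (ML u i)) (MH (τU u) (ω i))}}

/-- suppose `(M_H, I_H)` is a τ-abstraction of `(M_L, I_L)`,
`(M_L, I_L)` is similar to `(M_L', I_L)` and is a `d_max`-α-approximation of
`(M_L', I_L)`, and `k ≥ 0` is such that for every intervention in `I_L` and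
every low-level context,
`d_{V_H}(τ(M_L'(u, X ← x)), τ(M_L(u, X ← x))) ≤ k · d_{V_L}(M_L'(u, X ← x), M_L(u, X ← x))`.
Then `(M_H, I_H)` is a τ-(k·α)-approximate abstraction of `(M_L', I_L)`. -/
theorem approximation_then_abstraction
    {CtxL CtxH VL VH : Type} {RL : VL → Type} {RH : VH → Type}
    [Fintype VL] [Fintype VH] [DecidableEq VL] [DecidableEq VH]
    [∀ v, Fintype (RL v)] [∀ v, Fintype (RH v)]
    [∀ v, Nonempty (RL v)] [∀ v, Nonempty (RH v)]
    [Fintype CtxL] [Fintype CtxH] [Nonempty CtxL] [Nonempty CtxH]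
    (dL : (∀ v, RL v) → (∀ v, RL v) → ℝ)
    (hdL0 : ∀ a b, dL a b = 0 ↔ a = b)
    (hdLsymm : ∀ a b, dL a b = dL b a)
    (hdLtri : ∀ a b c, dL a c ≤ dL a b + dL b c)
    (dH : (∀ v, RH v) → (∀ v, RH v) → ℝ)
    (hdH0 : ∀ a b, dH a b = 0 ↔ a = b)
    (hdHsymm : ∀ a b, dH a b = dH b a)
    (hdHtri : ∀ a b c, dH a c ≤ dH a b + dH b c)
    (τ : (∀ v, RL v) → (∀ v, RH v))
    (ω : Intervention VL RL → Intervention VH RH)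
    (IL : Set (Intervention VL RL)) (IH : Set (Intervention VH RH))
    (ML ML' : CtxL → Intervention VL RL → (∀ v, RL v))
    (MH : CtxH → Intervention VH RH → (∀ v, RH v))
    (α k : ℝ) (hk : 0 ≤ k)
    -- τ-consistency of (M_L, I_L) and (M_H, I_H):
    (hτsurj : Function.Surjective τ)
    (hω : ∀ i ∈ IL, τ '' Rst i = Rst (ω i))
    (hIH : IH = ω '' IL)
    (hcard : Fintype.card CtxH ≤ Fintype.card CtxL)
    -- (M_H, I_H) is a τ-abstraction of (M_L, I_L):
    (habs : ∃ τU : CtxL → CtxH, Function.Surjective τU ∧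
        ∀ (u : CtxL), ∀ i ∈ IL, τ (ML u i) = MH (τU u) (ω i))
    -- (M_L, I_L) is a d_max-α-approximation of (M_L', I_L):
    (happrox : dMax dL IL ML ML' ≤ α)
    -- the Lipschitz-type bound defining k:
    (hkbound : ∀ i ∈ IL, ∀ u : CtxL,
        dH (τ (ML' u i)) (τ (ML u i)) ≤ k * dL (ML' u i) (ML u i)) :
    dTau dH τ ω IL ML' MH ≤ k * α := by
  obtain ⟨τU, hs, hτU⟩ := habs
  have hHnn : ∀ a b, 0 ≤ dH a b := fun a b => by
    have h1 := hdHtri a b a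
    rw [(hdH0 a a).2 rfl, hdHsymm b a] at h1
    linarith
  have hLnn : ∀ a b, 0 ≤ dL a b := fun a b => by
    have h1 := hdLtri a b a
    rw [(hdL0 a a).2 rfl, hdLsymm b a] at h1
    linarith
  have hα : 0 ≤ α := by
    refine le_trans (Real.sSup_nonneg ?_) happrox
    rintro b ⟨i, _, u, rfl⟩
    exact hLnn _ _
  have hbdd : BddAbove {b | ∃ i ∈ IL, ∃ u : CtxL, b = dL (ML u i) (ML' u i)} := by
    refine ((Set.finite_range (fun p : (∀ v, RL v) × (∀ v, RL v) => dL p.1 p.2)).subset ?_).bddAbove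
    rintro b ⟨i, _, u, rfl⟩
    exact ⟨(ML u i, ML' u i), rfl⟩
  have hle : ∀ i ∈ IL, ∀ u, dL (ML u i) (ML' u i) ≤ α := fun i hi u =>
    le_trans (le_csSup hbdd ⟨i, hi, u, rfl⟩) happrox
  unfold dTau
  refine le_trans (csInf_le ⟨0, ?_⟩ ⟨τU, hs, rfl⟩) ?_
  · rintro a ⟨t, _, rfl⟩
    refine Real.sSup_nonneg ?_
    rintro b ⟨i, _, u, rfl⟩
    exact hHnn _ _
  · refine Real.sSup_le ?_ (mul_nonneg hk hα)
    rintro b ⟨i, hi, u, rfl⟩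
    rw [← hτU u i hi]
    refine (hkbound i hi u).trans (mul_le_mul_of_nonneg_left ?_ hk)
    rw [hdLsymm]
    exact hle i hi u
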